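/- arXiv:1311.1091 — 3 statements merged into one kernel-verified Lean document; each statement's English description precedes it below -/
import Mathlib

section
/- The sequence (α_k)_{k≥1} tends to 0 as k → ∞. -/
open Filter

/-- `α_1 = 2` and `α_k = ρ(k, α_{k-1})` for `k ≥ 2`, where
`ρ(k,t) = (√(4 + (k−1)·k·t²) − 2)/(k−1)`. -/
noncomputable def alphaSeq : ℕ → ℝ
  | 0 => 0
  | 1 => 2
  | (k+2) => (Real.sqrt (4 + ((k+1 : ℕ) : ℝ) * ((k+2 : ℕ) : ℝ) * alphaSeq (k+1) ^ 2) - 2)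
      / ((k+1 : ℕ) : ℝ)

theorem alpha_nonneg_aux (n : ℕ) : 0 ≤ alphaSeq n := by
  match n with
  | 0 => simp [alphaSeq]
  | 1 => simp [alphaSeq]
  | (k+2) =>
    rw [alphaSeq]
    apply div_nonneg _ (by positivity)
    rw [sub_nonneg]
    apply Real.le_sqrt_of_sq_le
    have : 0 ≤ ((k+1 : ℕ) : ℝ) * ((k+2 : ℕ) : ℝ) * alphaSeq (k+1) ^ 2 := by positivity
    linarith

theorem alpha_step_aux (k : ℕ) (A X : ℝ) (hA : alphaSeq (k+1) ≤ A) (hX : 0 ≤ X)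
    (h : ((k:ℝ)+2) * A^2 ≤ ((k:ℝ)+1) * X^2 + 4 * X) : alphaSeq (k+2) ≤ X := by
  have h0 := alpha_nonneg_aux (k+1)
  have hk : (0:ℝ) < (k:ℝ)+1 := by positivity
  rw [alphaSeq]
  push_cast
  rw [div_le_iff₀ hk, sub_le_iff_le_add]
  apply Real.sqrt_le_iff.mpr
  refine ⟨by positivity, ?_⟩
  have h1 : alphaSeq (k+1) ^ 2 ≤ A^2 := by gcongr
  have h2 : ((k:ℝ)+2) * alphaSeq (k+1) ^ 2 ≤ ((k:ℝ)+1) * X^2 + 4 * X :=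
    le_trans (by gcongr) h
  have h3 := mul_le_mul_of_nonneg_left h2 hk.le
  nlinarith [h3]

theorem alpha_bound_aux (n : ℕ) : alphaSeq (n+7) ≤ 1 / ((n:ℝ)+7) := by
  induction n with
  | zero =>
    have a1 : alphaSeq 1 ≤ 2 := by simp [alphaSeq]
    have a2 := alpha_step_aux 0 _ (1.4642) a1 (by norm_num) (by norm_num)
    have a3 := alpha_step_aux 1 _ (1.054) a2 (by norm_num) (by norm_num)
    have a4 := alpha_step_aux 2 _ (0.722) a3 (by norm_num) (by norm_num)
    have a5 := alpha_step_aux 3 _ (0.451) a4 (by norm_num) (by norm_num)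
    have a6 := alpha_step_aux 4 _ (0.238) a5 (by norm_num) (by norm_num)
    have a7 := alpha_step_aux 5 _ (1/7) a6 (by norm_num) (by norm_num)
    simpa using a7
  | succ n ih =>
    have hn : (0:ℝ) ≤ n := by positivity
    have := alpha_step_aux (n+6) _ (1 / ((n:ℝ)+8)) ih (by positivity) (by
      push_cast
      have h1 : ((n:ℝ)+6+2) * (1 / ((n:ℝ)+7))^2 ≤ 4 * (1 / ((n:ℝ)+8)) := by
        rw [div_pow, one_pow, mul_one_div, mul_one_div, div_le_div_iff₀ (by positivity) (by positivity)]
        nlinarith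
      have h2 : 0 ≤ ((n:ℝ)+6+1) * (1 / ((n:ℝ)+8))^2 := by positivity
      linarith)
    push_cast
    rw [show (n:ℝ)+1+7 = n+8 by ring]
    exact this

/-- The sequence `(α_k)_{k ≥ 1}` tends to `0` as `k → ∞`. -/
theorem alphaSeq_tendsto_zero : Tendsto alphaSeq atTop (nhds 0) := by
  rw [← tendsto_add_atTop_iff_nat 7]
  refine squeeze_zero (fun n => alpha_nonneg_aux (n+7)) alpha_bound_aux ?_
  have h := (tendsto_add_atTop_iff_nat 7).mpr (tendsto_one_div_atTop_nhds_zero_nat (𝕜 := ℝ))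
  simpa using h
end

section
/- The following rational upper bounds hold: α_1 ≤ 2, α_2 ≤ 3/2, α_3 ≤ 9/8, α_4 ≤ 4/5, α_5 ≤ 3/5, α_6 ≤ 2/5, α_7 ≤ 1/4, α_8 ≤ 1/8, α_9 ≤ 1/30, and α_{10} ≤ 1/300. -/
open Filter

lemma alphaSeq_nonneg (k : ℕ) : 0 ≤ alphaSeq k := by
  match k with
  | 0 => simp [alphaSeq]
  | 1 => simp [alphaSeq]
  | (k+2) =>
    rw [alphaSeq]
    apply div_nonneg _ (Nat.cast_nonneg _)
    rw [sub_nonneg]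
    apply Real.le_sqrt_of_sq_le
    have : 0 ≤ ((k+1 : ℕ) : ℝ) * ((k+2 : ℕ) : ℝ) * alphaSeq (k+1) ^ 2 := by positivity
    linarith

lemma alphaSeq_step (k : ℕ) (b c : ℝ) (h : alphaSeq (k+1) ≤ b) (hc : 0 ≤ c)
    (hb : 4 + ((k+1 : ℕ) : ℝ) * ((k+2 : ℕ) : ℝ) * b ^ 2 ≤ (c * ((k+1 : ℕ) : ℝ) + 2) ^ 2) :
    alphaSeq (k+2) ≤ c := by
  have h0 := alphaSeq_nonneg (k+1)
  rw [alphaSeq, div_le_iff₀ (by positivity), sub_le_iff_le_add]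
  apply Real.sqrt_le_iff.mpr
  refine ⟨by positivity, le_trans ?_ hb⟩
  gcongr

/-- Rational upper bounds for `α_k`, `1 ≤ k ≤ 10`. -/
theorem alphaSeq_initial_bounds :
    alphaSeq 1 ≤ 2 ∧ alphaSeq 2 ≤ 3/2 ∧ alphaSeq 3 ≤ 9/8 ∧ alphaSeq 4 ≤ 4/5 ∧
    alphaSeq 5 ≤ 3/5 ∧ alphaSeq 6 ≤ 2/5 ∧ alphaSeq 7 ≤ 1/4 ∧ alphaSeq 8 ≤ 1/8 ∧
    alphaSeq 9 ≤ 1/30 ∧ alphaSeq 10 ≤ 1/300 := by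
  have h1 : alphaSeq 1 ≤ 2 := by simp [alphaSeq]
  have h2 := alphaSeq_step 0 2 (3/2) h1 (by norm_num) (by norm_num)
  have h3 := alphaSeq_step 1 (3/2) (9/8) h2 (by norm_num) (by norm_num)
  have h4 := alphaSeq_step 2 (9/8) (4/5) h3 (by norm_num) (by norm_num)
  have h5 := alphaSeq_step 3 (4/5) (3/5) h4 (by norm_num) (by norm_num)
  have h6 := alphaSeq_step 4 (3/5) (2/5) h5 (by norm_num) (by norm_num)
  have h7 := alphaSeq_step 5 (2/5) (1/4) h6 (by norm_num) (by norm_num)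
  have h8 := alphaSeq_step 6 (1/4) (1/8) h7 (by norm_num) (by norm_num)
  have h9 := alphaSeq_step 7 (1/8) (1/30) h8 (by norm_num) (by norm_num)
  have h10 := alphaSeq_step 8 (1/30) (1/300) h9 (by norm_num) (by norm_num)
  exact ⟨h1, h2, h3, h4, h5, h6, h7, h8, h9, h10⟩
end

section
/- There are constants c₁ > 0 and c₂ > 0 such that for all integers j ≥ 0, exp(−c₁·2^j) ≤ f(k₀ + j) ≤ exp(−c₂·2^j). -/
/-- `fAux j = f(k₀ + j)` where `k₀ = 10`, `f(k₀) = 1/100` and `f(k+1) = f(k)²·(k+1)`. -/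
noncomputable def fAux : ℕ → ℝ
  | 0 => 1/100
  | (j+1) => fAux j ^ 2 * ((10 + j + 1 : ℕ) : ℝ)

/-- `fSeq k = f(k)` for `k ≥ 10`: `f(10) = 1/100` and `f(k+1) = f(k)²·(k+1)` for `k ≥ 10`. -/
noncomputable def fSeq (k : ℕ) : ℝ := fAux (k - 10)

/-- **Lemma (estimates on `f`).** There are constants `c₁ > 0` and `c₂ > 0` such that
for all integers `j ≥ 0`, `exp(−c₁·2^j) ≤ f(k₀ + j) ≤ exp(−c₂·2^j)`, where `k₀ = 10`. -/
theorem f_estimate :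
    ∃ c₁ c₂ : ℝ, 0 < c₁ ∧ 0 < c₂ ∧
      ∀ j : ℕ, Real.exp (-c₁ * 2 ^ j) ≤ fSeq (10 + j) ∧
        fSeq (10 + j) ≤ Real.exp (-c₂ * 2 ^ j) := by
  have e : ∀ j, fSeq (10 + j) = fAux j := fun j => by simp [fSeq]
  have x : ∀ (a : ℝ), 0 < a → ∀ j : ℕ, Real.exp (-(-Real.log a) * 2 ^ j) = a ^ (2 ^ j) := by
    intro a ha j
    rw [neg_neg, mul_comm]
    have := Real.exp_nat_mul (Real.log a) (2 ^ j)
    rw [Real.exp_log ha] at this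
    push_cast at this
    exact this
  have lo : ∀ j : ℕ, (1 / 100 : ℝ) ^ (2 ^ j) ≤ fAux j := by
    intro j
    induction j with
    | zero => simp [fAux]
    | succ j ih =>
      rw [pow_succ, pow_mul, fAux]
      have h1 : ((1 / 100 : ℝ) ^ (2 ^ j)) ^ 2 ≤ fAux j ^ 2 := by gcongr
      have h2 : (1 : ℝ) ≤ ((10 + j + 1 : ℕ) : ℝ) := by exact_mod_cast (by omega : 1 ≤ 10 + j + 1)
      nlinarith [sq_nonneg (fAux j)]
  have pos : ∀ j, 0 < fAux j := fun j => lt_of_lt_of_le (by positivity) (lo j)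
  have hi : ∀ j : ℕ, fAux j * (j + 13) ≤ (13 / 100 : ℝ) ^ (2 ^ j) := by
    intro j
    induction j with
    | zero => norm_num [fAux]
    | succ j ih =>
      rw [pow_succ, pow_mul, fAux]
      have hp := pos j
      have h1 : (fAux j * (j + 13)) ^ 2 ≤ ((13 / 100 : ℝ) ^ (2 ^ j)) ^ 2 := by gcongr
      refine le_trans ?_ h1
      have hj : (0 : ℝ) ≤ j := Nat.cast_nonneg j
      rw [mul_pow, mul_assoc]
      refine mul_le_mul_of_nonneg_left ?_ (sq_nonneg _)
      push_cast
      nlinarith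
  refine ⟨-Real.log (1 / 100), -Real.log (13 / 100), ?_, ?_, fun j => ?_⟩
  · exact neg_pos.2 (Real.log_neg (by norm_num) (by norm_num))
  · exact neg_pos.2 (Real.log_neg (by norm_num) (by norm_num))
  · rw [e, x _ (by norm_num), x _ (by norm_num)]
    refine ⟨lo j, le_trans ?_ (hi j)⟩
    have hj : (0 : ℝ) ≤ j := Nat.cast_nonneg j
    nlinarith [pos j]
end
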